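/- Let g₀ : ℝ^d → ℂ be an even function with g₀(0) = 0, and for x = (x_1,…,x_N) ∈ (ℝ^d)^N set V₀(x) = (2/((N−1)N)) Σ_{1≤j₁<j₂≤N} g₀(x_{j₁} − x_{j₂}). Let 𝒮 be a random map taking each of the N(N−1) values S_{(i,j)} (i ≠ j), where S_{(i,j)}x is the configuration obtained from x by replacing the j-th coordinate by x_i, with equal probability 1/((N−1)N). Then for every x ∈ (ℝ^d)^N, E V₀(𝒮x) = (1 − 2/((N−1)N)) V₀(x). -/

import Mathlib

noncomputable section

abbrev Euc (d : ℕ) := EuclideanSpace ℝ (Fin d)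

/-- `V₀(x) = (2/((N-1)N)) Σ_{j₁<j₂} g₀(x_{j₁} - x_{j₂})` -/
def V0 {d N : ℕ} (g₀ : Euc d → ℂ) (x : Fin N → Euc d) : ℂ :=
  (2 / (((N : ℂ) - 1) * N)) *
    ∑ ij ∈ Finset.univ.filter (fun ij : Fin N × Fin N => ij.1 < ij.2),
      g₀ (x ij.1 - x ij.2)

/-- Changing one coordinate of `x` changes a single term of `∑ a, F (x a)`. -/
theorem sum_comp_update {ι α M : Type*} [Fintype ι] [DecidableEq ι] [AddCommGroup M]
    (F : α → M) (x : ι → α) (j : ι) (u : α) :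
    ∑ a, F (Function.update x j u a) = ∑ a, F (x a) - F (x j) + F u := by
  have h : ∀ a, F (Function.update x j u a) = F (x a) + if a = j then F u - F (x j) else 0 := by
    intro a
    by_cases hj : a = j
    · subst hj
      simp
    · simp [hj]
  simp only [h, Finset.sum_add_distrib, Finset.sum_ite_eq', Finset.mem_univ, if_true]
  abel

/-- For an even function, the sum of differences over all pairs, in terms of the same sum before
the `j`-th coordinate is synchronized with the `i`-th. -/
theorem sum_sum_sub_update {ι E R : Type*} [Fintype ι] [DecidableEq ι] [AddCommGroup E]
    [CommRing R] {g : E → R} (heven : ∀ a, g (-a) = g a) (hzero : g 0 = 0) (x : ι → E)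
    (i j : ι) :
    ∑ a, ∑ b, g (Function.update x j (x i) a - Function.update x j (x i) b) =
      ∑ a, ∑ b, g (x a - x b) - 2 * ∑ b, g (x j - x b) + 2 * ∑ b, g (x i - x b)
        - 2 * g (x i - x j) := by
  have hsymm : ∀ a b, g (x a - x b) = g (x b - x a) := fun a b => by
    rw [← heven, neg_sub]
  have hinner : ∀ v, ∑ b, g (v - Function.update x j (x i) b) =
      ∑ b, g (v - x b) - g (v - x j) + g (v - x i) := fun v =>
    sum_comp_update (fun w => g (v - w)) x j (x i)
  simp only [hinner]
  rw [sum_comp_update (fun v => ∑ b, g (v - x b) - g (v - x j) + g (v - x i)) x j (x i)]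
  simp only [Finset.sum_add_distrib, Finset.sum_sub_distrib, sub_self, hzero]
  rw [Finset.sum_congr rfl fun a _ => hsymm a j, Finset.sum_congr rfl fun a _ => hsymm a i,
    hsymm j i]
  ring

/-- A symmetric function vanishing on the diagonal sums over all pairs to twice its sum over
increasing pairs. -/
theorem sum_sum_eq_two_mul_sum_lt {ι R : Type*} [Fintype ι] [LinearOrder ι] [CommRing R]
    (G : ι → ι → R) (hsymm : ∀ a b, G a b = G b a) (hdiag : ∀ a, G a a = 0) :
    ∑ a, ∑ b, G a b =
      2 * ∑ p ∈ Finset.univ.filter (fun p : ι × ι => p.1 < p.2), G p.1 p.2 := by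
  have hsplit : ∀ a b, G a b = (if a < b then G a b else 0) + if b < a then G b a else 0 := by
    intro a b
    rcases lt_trichotomy a b with h | rfl | h
    · simp [h, h.not_gt]
    · simp [hdiag]
    · simp [h, h.not_gt, hsymm a b]
  rw [Finset.sum_filter, Fintype.sum_prod_type, two_mul]
  rw [Finset.sum_congr rfl fun a _ => Finset.sum_congr rfl fun b _ => hsplit a b]
  simp only [Finset.sum_add_distrib]
  rw [Finset.sum_comm (f := fun a b => if b < a then G b a else 0)]

theorem V0_eq_sum_sum {d N : ℕ} {g₀ : Euc d → ℂ} (heven : ∀ a, g₀ (-a) = g₀ a)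
    (hzero : g₀ 0 = 0) (x : Fin N → Euc d) :
    V0 g₀ x = (((N : ℂ) - 1) * N)⁻¹ * ∑ a, ∑ b, g₀ (x a - x b) := by
  rw [V0, sum_sum_eq_two_mul_sum_lt (fun a b => g₀ (x a - x b))
    (fun a b => by rw [← heven, neg_sub]) (fun a => by simp [hzero])]
  ring

/-- Let `g₀ : ℝ^d → ℂ` be even with `g₀(0) = 0` and let `V₀` be as
above.  Let `𝒮` be the random synchronization map taking each value `S_{(i,j)}`
(`i ≠ j`), which replaces the `j`-th coordinate of the configuration by the `i`-th,
with equal probability `1/((N-1)N)`.  Then for every configuration `x`,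
`E V₀(𝒮x) = (1 - 2/((N-1)N)) V₀(x)`; the expectation over the uniform random map is
written out as the corresponding uniformly weighted sum. -/
theorem expected_V0_after_sync_jump
    {d N : ℕ} (hN : 2 ≤ N) (g₀ : Euc d → ℂ)
    (heven : ∀ a : Euc d, g₀ (-a) = g₀ a) (hzero : g₀ 0 = 0)
    (x : Fin N → Euc d) :
    (∑ ij ∈ Finset.univ.filter (fun ij : Fin N × Fin N => ij.1 ≠ ij.2),
        (((N : ℂ) - 1) * N)⁻¹ * V0 g₀ (Function.update x ij.2 (x ij.1)))
      = (1 - 2 / (((N : ℂ) - 1) * N)) * V0 g₀ x := by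
  have hN₀ : (N : ℂ) ≠ 0 := by exact_mod_cast (by omega : N ≠ 0)
  have hN₁ : (N : ℂ) - 1 ≠ 0 := sub_ne_zero.2 (by exact_mod_cast (by omega : N ≠ 1))
  have hoff : ∀ f : Fin N → Fin N → ℂ,
      ∑ p ∈ Finset.univ.filter (fun p : Fin N × Fin N => p.1 ≠ p.2), f p.1 p.2 =
        ∑ i, ∑ j, f i j - ∑ i, f i i := by
    intro f
    rw [Finset.sum_filter, Fintype.sum_prod_type, ← Finset.sum_sub_distrib]
    refine Finset.sum_congr rfl fun i _ => ?_
    rw [eq_sub_iff_add_eq, ← Finset.sum_filter,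
      ← Finset.sum_filter_add_sum_filter_not Finset.univ (fun j => i ≠ j)]
    simp [Finset.filter_eq]
  simp only [V0_eq_sum_sum heven hzero, sum_sum_sub_update heven hzero, ← Finset.mul_sum]
  rw [hoff fun i j => ∑ a, ∑ b, g₀ (x a - x b) - 2 * ∑ b, g₀ (x j - x b)
    + 2 * ∑ b, g₀ (x i - x b) - 2 * g₀ (x i - x j)]
  simp only [Finset.sum_add_distrib, Finset.sum_sub_distrib, ← Finset.mul_sum, sub_self, hzero,
    Finset.sum_const, Finset.card_univ, Fintype.card_fin, nsmul_eq_mul]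
  field_simp
  ring
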